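/- arXiv:1403.5770 — 4 statements merged into one kernel-verified Lean document; each statement's English description precedes it below -/
import Mathlib

section
/- Let X be a real separable Banach space, Ω ⊆ X an open set, and H a real separable Hilbert space. Let ν be a finite Borel measure on X with ν(X \ Ω) = 0, and let σ : X → H be Borel measurable with ‖σ(x)‖_H = 1 for ν-almost every x. Then ν(Ω) = sup { ∫_Ω ⟨σ(x), φ(x)⟩_H dν(x) : φ : X → H Lipschitz continuous with respect to the norm of X, φ(x) = 0 for every x ∈ X \ Ω, and ‖φ(x)‖_H ≤ 1 for every x ∈ X }. (Lemma 2.4, stated via the polar decomposition μ = σ|μ| of an H-valued measure: the total variation of μ on Ω is attained on Lipschitz test functions vanishing outside Ω.) -/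
open MeasureTheory Set Filter
open scoped ENNReal RealInnerProductSpace

/-- The indicator of a closed set is approximated in mean by Lipschitz functions. -/
lemma tv_exists_thick {X : Type*} [NormedAddCommGroup X] [MeasurableSpace X] [BorelSpace X]
    (ν : Measure X) [IsFiniteMeasure ν] {F : Set X} (hF : IsClosed F) {ε : ℝ} (hε : 0 < ε) :
    ∃ ψ : X → ℝ, (∃ K : NNReal, LipschitzWith K ψ) ∧ (∀ x, 0 ≤ ψ x) ∧ (∀ x, ψ x ≤ 1) ∧
      (∀ x ∈ F, ψ x = 1) ∧ Integrable ψ ν ∧ ∫ x, ψ x ∂ν ≤ ν.real F + ε := by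
  have hpos : ∀ n : ℕ, (0 : ℝ) < 1 / ((n : ℝ) + 1) := fun n => Nat.one_div_pos_of_nat
  have h := tendsto_integral_thickenedIndicator_of_isClosed ν hF hpos
    tendsto_one_div_add_atTop_nhds_zero_nat
  obtain ⟨n, hn⟩ := (h.eventually_lt_const (lt_add_of_pos_right (ν.real F) hε)).exists
  refine ⟨fun x => (thickenedIndicator (hpos n) F x : ℝ), ⟨_,
    (NNReal.isometry_coe.lipschitz).comp (lipschitzWith_thickenedIndicator (hpos n) F)⟩,
    fun x => NNReal.coe_nonneg _,
    fun x => ?_, fun x hx => ?_, integrable_thickenedIndicator F (hpos n), hn.le⟩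
  · exact_mod_cast thickenedIndicator_le_one (hpos n) F x
  · simp only [thickenedIndicator_one (hpos n) F hx, NNReal.coe_one]

/-- The radial retraction onto the unit ball is 2-Lipschitz. -/
lemma tv_retract {H : Type*} [NormedAddCommGroup H] [NormedSpace ℝ H] :
    ∃ T : H → H, LipschitzWith 2 T ∧ (∀ y, ‖T y‖ ≤ 1) ∧ ∀ y, ‖y‖ ≤ 1 → T y = y := by
  refine ⟨fun y => (max 1 ‖y‖)⁻¹ • y, ?_, ?_, ?_⟩
  · refine LipschitzWith.of_dist_le_mul fun y z => ?_
    rw [dist_eq_norm, dist_eq_norm]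
    have ha : 1 ≤ max 1 ‖y‖ := le_max_left _ _
    have hb : 1 ≤ max 1 ‖z‖ := le_max_left _ _
    have hz : ‖z‖ ≤ max 1 ‖z‖ := le_max_right _ _
    have hd : |max 1 ‖z‖ - max 1 ‖y‖| ≤ ‖y - z‖ := by
      have h1 := abs_max_sub_max_le_abs ‖z‖ ‖y‖ 1
      rw [max_comm 1, max_comm 1]
      exact h1.trans ((abs_norm_sub_norm_le z y).trans (norm_sub_rev z y).le)
    set a := max 1 ‖y‖
    set b := max 1 ‖z‖
    have ha0 : 0 < a := by linarith
    have hb0 : 0 < b := by linarith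
    have e : a⁻¹ • y - b⁻¹ • z = a⁻¹ • ((y - z) + ((b - a) * b⁻¹) • z) := by
      have : b⁻¹ = a⁻¹ * (1 - (b - a) * b⁻¹) := by field_simp; ring
      rw [smul_add, smul_sub, smul_smul]
      nth_rewrite 1 [this]
      rw [mul_sub, sub_smul, mul_one]
      abel
    rw [e, norm_smul, Real.norm_of_nonneg (inv_nonneg.2 ha0.le)]
    have h2 : ‖((b - a) * b⁻¹) • z‖ ≤ ‖y - z‖ := by
      rw [norm_smul, norm_mul, Real.norm_eq_abs, Real.norm_of_nonneg (inv_nonneg.2 hb0.le), mul_assoc]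
      have : b⁻¹ * ‖z‖ ≤ 1 := by
        rw [inv_mul_le_iff₀ hb0]; linarith
      calc _ ≤ |b - a| * 1 := by gcongr
        _ ≤ _ := by linarith
    have h3 := norm_add_le (y - z) (((b - a) * b⁻¹) • z)
    have h4 : a⁻¹ ≤ 1 := inv_le_one_of_one_le₀ ha
    calc _ ≤ 1 * (‖y - z‖ + ‖y - z‖) := by gcongr; linarith
      _ = _ := by push_cast; ring
  · intro y
    have h0 : 0 < max 1 ‖y‖ := lt_of_lt_of_le one_pos (le_max_left _ _)
    rw [norm_smul, Real.norm_of_nonneg (inv_nonneg.2 h0.le), inv_mul_le_iff₀ h0, mul_one]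
    exact le_max_right _ _
  · intro y hy
    simp [max_eq_left hy]

/-- Lipschitz functions are dense in `L¹`. -/
lemma tv_dense {X H : Type*} [NormedAddCommGroup X] [TopologicalSpace.SeparableSpace X]
    [MeasurableSpace X] [BorelSpace X]
    [NormedAddCommGroup H] [NormedSpace ℝ H]
    (ν : Measure X) [IsFiniteMeasure ν] {f : X → H} (hf : Integrable f ν) {ε : ℝ} (hε : 0 < ε) :
    ∃ g : X → H, (∃ K : NNReal, LipschitzWith K g) ∧ Integrable (fun x => f x - g x) ν ∧
      ∫ x, ‖f x - g x‖ ∂ν ≤ ε := by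
  have : SecondCountableTopology X := UniformSpace.secondCountable_of_separable X
  have hP : ∀ g : X → H, (∃ K : NNReal, LipschitzWith K g) → AEStronglyMeasurable g ν := by
    rintro g ⟨K, hK⟩
    exact hK.continuous.aestronglyMeasurable
  have hI : ∀ (c : H) ⦃s : Set X⦄, MeasurableSet s → ν s < ∞ → ∀ {ε : ℝ≥0∞}, ε ≠ 0 →
      ∃ g : X → H, eLpNorm (g - s.indicator fun _ => c) 1 ν ≤ ε ∧
        ∃ K : NNReal, LipschitzWith K g := by
    intro c s hs _ ε hε
    obtain ⟨r, hr0, hrε⟩ : ∃ r : ℝ, 0 < r ∧ ENNReal.ofReal r ≤ ε := by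
      obtain ⟨r, h0, h1⟩ := ENNReal.lt_iff_exists_nnreal_btwn.1 (pos_iff_ne_zero.2 hε)
      exact ⟨r, by exact_mod_cast h0, by simpa using h1.le⟩
    set η : ℝ := r / (2 * (‖c‖ + 1)) with hη
    have hη0 : 0 < η := by positivity
    obtain ⟨F, hFs, hFc, hF⟩ := hs.exists_isClosed_sdiff_lt (measure_ne_top ν s)
      (ε := ENNReal.ofReal η) (by simpa using hη0)
    obtain ⟨ψ, ⟨K, hK⟩, h0, h1, hψF, hψi, hψ⟩ := tv_exists_thick ν hFc hη0
    have hLip : LipschitzWith (‖c‖₊ * K) (fun x => ψ x • c) := by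
      refine LipschitzWith.of_dist_le_mul fun x y => ?_
      rw [dist_eq_norm, ← sub_smul, norm_smul, ← dist_eq_norm]
      have := hK.dist_le_mul x y
      push_cast
      nlinarith [norm_nonneg c]
    refine ⟨fun x => ψ x • c, ?_, _, hLip⟩
    rw [eLpNorm_one_eq_lintegral_enorm]
    have hi : Integrable ((fun x => ψ x • c) - s.indicator fun _ => c) ν :=
      (hψi.smul_const c).sub ((integrable_const c).indicator hs)
    rw [← ofReal_integral_norm_eq_lintegral_enorm hi]
    refine (ENNReal.ofReal_le_ofReal ?_).trans hrε
    have hiF : Integrable (F.indicator fun _ => (1 : ℝ)) ν :=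
      (integrable_const _).indicator hFc.measurableSet
    have hisF : Integrable ((s \ F).indicator fun _ => (1 : ℝ)) ν :=
      (integrable_const _).indicator (hs.diff hFc.measurableSet)
    have hb : ν.real (s \ F) ≤ η := ENNReal.toReal_le_of_le_ofReal hη0.le hF.le
    calc _ ≤ ∫ x, ‖c‖ * ((ψ x - F.indicator (fun _ => (1 : ℝ)) x)
            + (s \ F).indicator (fun _ => (1 : ℝ)) x) ∂ν := by
          refine integral_mono hi.norm (((hψi.sub hiF).add hisF).const_mul _) fun x => ?_
          have hc := norm_nonneg c
          have a0 := h0 x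
          have a1 := h1 x
          by_cases hxF : x ∈ F
          · simp [hxF, hFs hxF, hψF x hxF]
          · by_cases hxs : x ∈ s
            · simp only [Pi.sub_apply, indicator_of_mem hxs, indicator_of_notMem hxF,
                indicator_of_mem (show x ∈ s \ F from ⟨hxs, hxF⟩)]
              have : ψ x • c - c = (ψ x - 1) • c := by rw [sub_smul, one_smul]
              rw [this, norm_smul, Real.norm_eq_abs, abs_of_nonpos (by linarith)]
              nlinarith
            · simp [hxF, hxs, norm_smul, abs_of_nonneg a0, mul_comm]
      _ = ‖c‖ * ((∫ x, ψ x ∂ν - ν.real F) + ν.real (s \ F)) := by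
          have hi1 : Integrable (fun x => ψ x - F.indicator (fun _ => (1 : ℝ)) x) ν := hψi.sub hiF
          rw [integral_const_mul, integral_add hi1 hisF, integral_sub hψi hiF,
            integral_indicator_const _ hFc.measurableSet,
            integral_indicator_const _ (hs.diff hFc.measurableSet)]
          simp
      _ ≤ ‖c‖ * (η + η) := by gcongr; linarith
      _ ≤ (‖c‖ + 1) * (η + η) := by gcongr; linarith
      _ = r := by rw [hη]; field_simp; ring
  have hA : ∀ f g : X → H, (∃ K : NNReal, LipschitzWith K f) →
      (∃ K : NNReal, LipschitzWith K g) → ∃ K : NNReal, LipschitzWith K (f + g) := by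
    rintro f g ⟨K, hK⟩ ⟨L, hL⟩
    exact ⟨K + L, hK.add hL⟩
  obtain ⟨g, hg, Pg⟩ := MemLp.induction_dense (μ := ν) (p := 1) ENNReal.one_ne_top
    (fun g : X → H => ∃ K : NNReal, LipschitzWith K g) hI hA hP (memLp_one_iff_integrable.2 hf)
    (ε := ENNReal.ofReal ε) (by simpa using hε)
  have hm : AEStronglyMeasurable (f - g) ν := hf.aestronglyMeasurable.sub (hP g Pg)
  rw [eLpNorm_one_eq_lintegral_enorm] at hg
  refine ⟨g, Pg, ⟨hm, lt_of_le_of_lt hg ENNReal.ofReal_lt_top⟩, ?_⟩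
  have := integral_norm_eq_lintegral_enorm hm
  simp only [Pi.sub_apply] at this hg
  rw [this]
  exact ENNReal.toReal_le_of_le_ofReal hε.le hg

theorem total_variation_sup_lipschitz {X H : Type*}
    [NormedAddCommGroup X] [NormedSpace ℝ X] [TopologicalSpace.SeparableSpace X]
    [CompleteSpace X] [MeasurableSpace X] [BorelSpace X]
    [NormedAddCommGroup H] [InnerProductSpace ℝ H] [TopologicalSpace.SeparableSpace H]
    [CompleteSpace H] [MeasurableSpace H] [BorelSpace H]
    (Ω : Set X) (hΩ : IsOpen Ω)
    (ν : Measure X) [IsFiniteMeasure ν] (hν : ν (Set.univ \ Ω) = 0)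
    (σ : X → H) (hσm : Measurable σ) (hσ : ∀ᵐ x ∂ν, ‖σ x‖ = 1) :
    ν Ω = ⨆ φ : {φ : X → H // (∃ K : NNReal, LipschitzWith K φ) ∧
        (∀ x ∉ Ω, φ x = 0) ∧ ∀ x, ‖φ x‖ ≤ 1},
      ENNReal.ofReal (∫ x in Ω, ⟪σ x, φ.1 x⟫ ∂ν) := by
  have : SecondCountableTopology X := UniformSpace.secondCountable_of_separable X
  have : SecondCountableTopology H := UniformSpace.secondCountable_of_separable H
  have hc : ν Ωᶜ = 0 := by rwa [← compl_eq_univ_sdiff] at hν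
  have hres : ν.restrict Ω = ν := by
    rw [Measure.restrict_eq_self_of_ae_mem]
    exact hc
  have huniv : ν Ω = ν univ := by
    conv_rhs => rw [← hres]
    simp
  rw [hres, huniv]
  have hσi : Integrable σ ν :=
    .of_bound hσm.aestronglyMeasurable 1 (hσ.mono fun x hx => hx.le)
  apply le_antisymm
  · refine ENNReal.le_of_forall_pos_le_add fun ε hε _ => ?_
    have hε' : (0 : ℝ) < ε / 4 := by positivity
    obtain ⟨T, hTL, hT1, hTid⟩ := tv_retract (H := H)
    obtain ⟨g, ⟨K, hK⟩, hgi, hg⟩ := tv_dense ν hσi hε'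
    obtain ⟨ψ, ⟨L, hL⟩, h0, h1, hψF, hψi, hψ⟩ := tv_exists_thick ν hΩ.isClosed_compl hε'
    have hLip : LipschitzWith (L + 2 * K) (fun x => (1 - ψ x) • T (g x)) := by
      refine LipschitzWith.of_dist_le_mul fun x y => ?_
      have e : (1 - ψ x) • T (g x) - (1 - ψ y) • T (g y)
          = (ψ y - ψ x) • T (g x) + (1 - ψ y) • (T (g x) - T (g y)) := by
        module
      rw [dist_eq_norm, e]
      refine (norm_add_le _ _).trans ?_
      rw [norm_smul, norm_smul, ← dist_eq_norm (ψ y) (ψ x), ← dist_eq_norm (T (g x)) (T (g y)),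
        dist_comm (ψ y),
        Real.norm_of_nonneg (by linarith [h1 y] : 0 ≤ 1 - ψ y)]
      have i1 := hL.dist_le_mul x y
      have i2 := (hTL.comp hK).dist_le_mul x y
      simp only [Function.comp] at i2
      push_cast at i2 ⊢
      have j1 : dist (ψ x) (ψ y) * ‖T (g x)‖ ≤ dist (ψ x) (ψ y) * 1 := by
        gcongr; exact hT1 _
      have j2 : (1 - ψ y) * dist (T (g x)) (T (g y)) ≤ 1 * dist (T (g x)) (T (g y)) := by
        gcongr; linarith [h0 y]
      linarith
    have hb : ∀ x, ‖(1 - ψ x) • T (g x)‖ ≤ 1 := fun x => by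
      rw [norm_smul, Real.norm_of_nonneg (by linarith [h1 x] : 0 ≤ 1 - ψ x)]
      exact mul_le_one₀ (by linarith [h0 x]) (norm_nonneg _) (hT1 _)
    let φ : {φ : X → H // (∃ K : NNReal, LipschitzWith K φ) ∧
        (∀ x ∉ Ω, φ x = 0) ∧ ∀ x, ‖φ x‖ ≤ 1} :=
      ⟨fun x => (1 - ψ x) • T (g x), ⟨_, hLip⟩, fun x hx => by simp [hψF x hx], hb⟩
    have key : ν.real univ ≤ ∫ x, ⟪σ x, φ.1 x⟫ ∂ν + ε := by
      have hint : Integrable (fun x => ⟪σ x, φ.1 x⟫) ν := by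
        refine .of_bound (hσm.aestronglyMeasurable.inner hLip.continuous.aestronglyMeasurable) 1
          (hσ.mono fun x hx => ?_)
        refine (norm_inner_le_norm _ _).trans ?_
        rw [hx, one_mul]
        exact hb x
      have hlow : Integrable (fun x => (1 - ψ x) - 2 * ‖σ x - g x‖) ν :=
        ((integrable_const 1).sub hψi).sub (hgi.norm.const_mul 2)
      have hle : ∫ x, ((1 - ψ x) - 2 * ‖σ x - g x‖) ∂ν ≤ ∫ x, ⟪σ x, φ.1 x⟫ ∂ν := by
        refine integral_mono_ae hlow hint (hσ.mono fun x hx => ?_)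
        have k1 : ‖σ x - T (g x)‖ ≤ 2 * ‖σ x - g x‖ := by
          have := hTL.dist_le_mul (σ x) (g x)
          rwa [hTid _ hx.le, dist_eq_norm, dist_eq_norm] at this
        have k2 : ⟪σ x, φ.1 x⟫ = (1 - ψ x) * (1 - ⟪σ x, σ x - T (g x)⟫) := by
          change ⟪σ x, (1 - ψ x) • T (g x)⟫ = _
          rw [real_inner_smul_right, inner_sub_right, real_inner_self_eq_norm_sq, hx]
          ring
        have k3 : ⟪σ x, σ x - T (g x)⟫ ≤ ‖σ x - T (g x)‖ := by
          have := real_inner_le_norm (σ x) (σ x - T (g x))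
          rwa [hx, one_mul] at this
        change _ ≤ ⟪σ x, φ.1 x⟫
        rw [k2]
        nlinarith [h0 x, h1 x, norm_nonneg (σ x - g x)]
      have hi1 : Integrable (fun x => 1 - ψ x) ν := (integrable_const 1).sub hψi
      rw [integral_sub hi1 (hgi.norm.const_mul 2),
        integral_sub (integrable_const 1) hψi, integral_const_mul] at hle
      have hcr : ν.real Ωᶜ = 0 := by simp [Measure.real, hc]
      simp only [integral_const, smul_eq_mul, mul_one] at hle
      linarith
    calc ν univ = ENNReal.ofReal (ν.real univ) := by simp [Measure.real]
      _ ≤ ENNReal.ofReal (∫ x, ⟪σ x, φ.1 x⟫ ∂ν + ε) := ENNReal.ofReal_le_ofReal key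
      _ ≤ ENNReal.ofReal (∫ x, ⟪σ x, φ.1 x⟫ ∂ν) + ENNReal.ofReal ε := ENNReal.ofReal_add_le
      _ ≤ _ := by
          rw [ENNReal.ofReal_coe_nnreal]
          gcongr
          exact le_iSup (fun φ : {φ : X → H // (∃ K : NNReal, LipschitzWith K φ) ∧
            (∀ x ∉ Ω, φ x = 0) ∧ ∀ x, ‖φ x‖ ≤ 1} =>
              ENNReal.ofReal (∫ x, ⟪σ x, φ.1 x⟫ ∂ν)) φ
  · refine iSup_le fun φ => ?_
    refine ENNReal.ofReal_le_of_le_toReal ?_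
    have h := norm_integral_le_of_norm_le_const (μ := ν) (f := fun x => ⟪σ x, φ.1 x⟫) (C := 1)
      (hσ.mono fun x hx => by
        refine (norm_inner_le_norm _ _).trans ?_
        rw [hx, one_mul]
        exact φ.2.2.2 x)
    rw [one_mul] at h
    exact (le_abs_self _).trans h
end

section
/- Let C, C_n ⊆ ℝ^d be closed convex sets, with C having nonempty interior, such that C_n converges to C in L¹_loc, i.e. for every R > 0 the Lebesgue measure of (C_n Δ C) ∩ B̄_R(0) tends to 0 as n → ∞. Then for every r > 0 and M > 0 there exist α > 0 and N ∈ ℕ such that for every n ≥ N and every x ∈ ∂C_n with ‖x‖ ≤ M, the Lebesgue measure of C_n ∩ B_r(x) is at least α. (Lemma A.2.) -/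
open Set Filter MeasureTheory

theorem convex_L1loc_convergence_lower_volume_bound {d : ℕ}
    (C : Set (EuclideanSpace ℝ (Fin d))) (Cn : ℕ → Set (EuclideanSpace ℝ (Fin d)))
    (hCcl : IsClosed C) (hCconv : Convex ℝ C) (hCint : (interior C).Nonempty)
    (hCncl : ∀ n, IsClosed (Cn n)) (hCnconv : ∀ n, Convex ℝ (Cn n))
    (hconv : ∀ R > (0 : ℝ),
      Tendsto (fun n => volume (((Cn n \ C) ∪ (C \ Cn n)) ∩ Metric.closedBall 0 R))
        atTop (nhds 0)) :
    ∀ r > (0 : ℝ), ∀ M > (0 : ℝ), ∃ α > (0 : ℝ), ∃ N : ℕ, ∀ n ≥ N,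
      ∀ x ∈ frontier (Cn n), ‖x‖ ≤ M →
        ENNReal.ofReal α ≤ volume (Cn n ∩ Metric.ball x r) := by
  intro r hr M hM
  obtain ⟨c, hc⟩ := hCint
  obtain ⟨ρ, hρ, hball⟩ := Metric.isOpen_iff.1 isOpen_interior c hc
  have hballC : Metric.ball c ρ ⊆ C := hball.trans interior_subset
  set v := volume (Metric.ball c ρ) with hv
  have hv0 : v ≠ 0 := (Metric.measure_ball_pos volume c hρ).ne'
  have hvt : v ≠ ⊤ := measure_ball_lt_top.ne
  have hv20 : 0 < v / 2 := ENNReal.half_pos hv0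
  have hc0 := norm_nonneg c
  set K : ℝ := M + ‖c‖ + ρ with hK
  have hKpos : 0 < K := by positivity
  set t : ℝ := min 1 (r / K) with ht
  have htpos : 0 < t := lt_min one_pos (div_pos hr hKpos)
  have ht1 : t ≤ 1 := min_le_left _ _
  have htK : t * K ≤ r := by
    have : t ≤ r / K := min_le_right _ _
    rwa [le_div_iff₀ hKpos] at this
  have hev := (hconv (‖c‖ + ρ) (by positivity)).eventually (gt_mem_nhds hv20)
  obtain ⟨N, hN⟩ := eventually_atTop.1 hev
  have hvr : 0 < (v / 2).toReal :=
    ENNReal.toReal_pos hv20.ne' (ENNReal.div_ne_top hvt (by norm_num))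
  refine ⟨t ^ d * (v / 2).toReal, by positivity, N, fun n hn x hx hxM => ?_⟩
  have hxC : x ∈ Cn n := (hCncl n).frontier_subset hx
  have hdiff : volume (Metric.ball c ρ \ Cn n) ≤ v / 2 := by
    refine (measure_mono ?_).trans (hN n hn).le
    rintro y ⟨hy, hyn⟩
    refine ⟨Or.inr ⟨hballC hy, hyn⟩, ?_⟩
    rw [Metric.mem_ball, dist_eq_norm] at hy
    rw [mem_closedBall_zero_iff]
    have := norm_add_le (y - c) c
    rw [sub_add_cancel] at this
    linarith
  have hA : v / 2 ≤ volume (Metric.ball c ρ ∩ Cn n) := by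
    have h1 := measure_inter_add_diff (μ := volume) (Metric.ball c ρ) (hCncl n).measurableSet
    have h2 : v / 2 + v / 2 ≤ volume (Metric.ball c ρ ∩ Cn n) + v / 2 := by
      rw [ENNReal.add_halves, hv, ← h1]
      gcongr
      rw [h1]; exact hdiff
    exact (ENNReal.add_le_add_iff_right (ENNReal.div_ne_top hvt (by norm_num))).1 h2
  have himg : AffineMap.homothety x t '' (Metric.ball c ρ ∩ Cn n) ⊆ Cn n ∩ Metric.ball x r := by
    rintro _ ⟨y, ⟨hy, hyn⟩, rfl⟩
    rw [AffineMap.homothety_apply, vsub_eq_sub, vadd_eq_add]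
    constructor
    · have := (hCnconv n).add_smul_sub_mem hxC hyn ⟨htpos.le, ht1⟩
      rwa [add_comm] at this
    · rw [Metric.mem_ball, dist_eq_norm, add_sub_cancel_right, norm_smul, Real.norm_of_nonneg htpos.le]
      rw [Metric.mem_ball, dist_eq_norm] at hy
      have h3 : ‖y - x‖ < K := by
        have e : y - x = (y - c) + c - x := by abel
        have h1 := norm_sub_le ((y - c) + c) x
        have h2 := norm_add_le (y - c) c
        rw [e]; linarith
      exact (mul_lt_mul_of_pos_left h3 htpos).trans_le htK
  calc ENNReal.ofReal (t ^ d * (v / 2).toReal)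
      = ENNReal.ofReal |t ^ d| * (v / 2) := by
        rw [ENNReal.ofReal_mul (by positivity), abs_of_nonneg (by positivity),
          ENNReal.ofReal_toReal (ENNReal.div_ne_top hvt (by norm_num))]
    _ ≤ ENNReal.ofReal |t ^ d| * volume (Metric.ball c ρ ∩ Cn n) := by gcongr
    _ = volume (AffineMap.homothety x t '' (Metric.ball c ρ ∩ Cn n)) := by
        rw [Measure.addHaar_image_homothety, finrank_euclideanSpace_fin]
    _ ≤ _ := measure_mono himg
end

section
/- Let C, C_n ⊆ ℝ^d be closed convex sets, with C having nonempty interior, such that γ(C Δ C_n) → 0 as n → ∞, where γ is the standard Gaussian measure on ℝ^d. Then the boundaries ∂C_n converge to ∂C uniformly on compact sets: for every R > 0 and every ε > 0 there exists N such that for all n ≥ N one has ∂C_n ∩ B̄_R(0) ⊆ {x : dist(x, ∂C) < ε} and ∂C ∩ B̄_R(0) ⊆ {x : dist(x, ∂C_n) < ε}. (Lemma A.3.) -/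
open Set Filter MeasureTheory Real

/-- The standard Gaussian measure on `ℝ^d`. -/
noncomputable def gaussianMeasure (d : ℕ) : Measure (EuclideanSpace ℝ (Fin d)) :=
  volume.withDensity fun x => ENNReal.ofReal ((2 * π) ^ (-(d : ℝ) / 2) * Real.exp (-‖x‖ ^ 2 / 2))


/-- A point outside a closed convex set is near balls of every radius avoiding the set. -/
theorem exists_ball_disjoint {d : ℕ} {S : Set (EuclideanSpace ℝ (Fin d))}
    (hcl : IsClosed S) (hconv : Convex ℝ S) {y : EuclideanSpace ℝ (Fin d)} (hy : y ∉ S)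
    {r : ℝ} (hr : 0 < r) : ∃ z, ‖z - y‖ ≤ r ∧ ∀ w ∈ Metric.ball z r, w ∉ S := by
  rcases S.eq_empty_or_nonempty with rfl | ⟨a, ha⟩
  · exact ⟨y, by simp [hr.le], by simp⟩
  obtain ⟨f, u, hf1, hf2⟩ := geometric_hahn_banach_closed_point hconv hcl hy
  obtain ⟨v, rfl⟩ := (InnerProductSpace.toDual ℝ (EuclideanSpace ℝ (Fin d))).surjective f
  simp only [InnerProductSpace.toDual_apply_apply] at hf1 hf2
  have hv : v ≠ 0 := by
    rintro rfl
    have := hf1 a ha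
    simp at this hf2
    linarith
  have hv' : 0 < ‖v‖ := norm_pos_iff.2 hv
  refine ⟨y + (r / ‖v‖) • v, ?_, ?_⟩
  · rw [add_sub_cancel_left, norm_smul, Real.norm_eq_abs, abs_of_pos (by positivity)]
    field_simp
    exact le_rfl
  · intro w hw hwS
    have h1 := hf1 w hwS
    rw [mem_ball_iff_norm] at hw
    have h2 := abs_real_inner_le_norm v (w - (y + (r / ‖v‖) • v))
    have h3 : ‖v‖ * ‖w - (y + (r / ‖v‖) • v)‖ < ‖v‖ * r := mul_lt_mul_of_pos_left hw hv'
    have h4 := neg_abs_le (inner ℝ v (w - (y + (r / ‖v‖) • v)))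
    rw [inner_sub_right, inner_add_right, inner_smul_right, real_inner_self_eq_norm_sq] at h2 h4
    have h5 : r / ‖v‖ * ‖v‖ ^ 2 = ‖v‖ * r := by field_simp
    rw [h5] at h2 h4
    linarith

theorem key_ball {d : ℕ} {A B : Set (EuclideanSpace ℝ (Fin d))}
    (hA : IsClosed A) (hAc : Convex ℝ A) (p x : EuclideanSpace ℝ (Fin d))
    {ρ R ε t r : ℝ} (hε : 0 < ε) (hpA : Metric.ball p ρ ⊆ A)
    (ht : 0 < t) (ht1 : t ≤ 1) (htε : t * (R + ‖p‖ + ρ) ≤ ε) (hr : 0 < r) (hrt : r ≤ t * ρ)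
    (hrε : r ≤ ε / 4) (hxA : x ∈ frontier A) (hxR : ‖x‖ ≤ R)
    (hx : ε ≤ Metric.infDist x (frontier B)) :
    ∃ z, ‖z‖ ≤ R + ε ∧ Metric.ball z r ⊆ (A \ B) ∪ (B \ A) := by
  have hdis : ∀ w ∈ Metric.ball x ε, w ∉ frontier B := by
    intro w hw hwB
    have := Metric.infDist_le_dist_of_mem (x := x) hwB
    rw [Metric.mem_ball, dist_comm] at hw
    linarith
  by_cases hsub : Metric.ball x ε ⊆ B
  · have hxc : x ∈ closure Aᶜ := by
      rw [frontier_eq_closure_inter_closure] at hxA; exact hxA.2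
    obtain ⟨y, hyA, hxy⟩ := Metric.mem_closure_iff.1 hxc r hr
    obtain ⟨z, hz, hzA⟩ := exists_ball_disjoint hA hAc hyA hr
    rw [dist_comm, dist_eq_norm] at hxy
    have hzx : ‖z - x‖ ≤ 2 * r := by
      have := norm_add_le (z - y) (y - x)
      rw [sub_add_sub_cancel] at this
      linarith
    refine ⟨z, ?_, ?_⟩
    · have := norm_add_le (z - x) x
      rw [sub_add_cancel] at this
      linarith
    · intro w hw
      refine Or.inr ⟨hsub ?_, hzA w hw⟩
      rw [mem_ball_iff_norm] at hw ⊢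
      have := norm_add_le (w - z) (z - x)
      rw [sub_add_sub_cancel] at this
      linarith
  · have hdisj : ∀ w ∈ Metric.ball x ε, w ∉ B := by
      intro w hw hwB
      obtain ⟨q, hq, hqB⟩ := not_subset.1 hsub
      have hmem : ∀ u ∈ Metric.ball x ε, u ∈ closure B → u ∈ interior B := by
        intro u hu hcu
        by_contra hiu
        exact hdis u hu ⟨hcu, hiu⟩
      obtain ⟨u, hu, huB, huB'⟩ := (convex_ball x ε).isPreconnected (interior B) (closure B)ᶜ
        isOpen_interior isClosed_closure.isOpen_compl
        (fun u hu => by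
          by_cases hcu : u ∈ closure B
          · exact Or.inl (hmem u hu hcu)
          · exact Or.inr hcu)
        ⟨w, hw, hmem w hw (subset_closure hwB)⟩
        ⟨q, hq, fun hcq => hqB (interior_subset (hmem q hq hcq))⟩
      exact huB' (subset_closure (interior_subset huB))
    have hxA' : x ∈ A := hA.frontier_subset hxA
    have hpx : ‖p - x‖ ≤ ‖p‖ + R := (norm_sub_le p x).trans (by linarith)
    have hzx : ‖((1 - t) • x + t • p) - x‖ ≤ t * (‖p‖ + R) := by
      have : ((1 - t) • x + t • p) - x = t • (p - x) := by module
      rw [this, norm_smul, Real.norm_eq_abs, abs_of_pos ht]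
      exact mul_le_mul_of_nonneg_left hpx ht.le
    refine ⟨(1 - t) • x + t • p, ?_, ?_⟩
    · have := norm_add_le (((1 - t) • x + t • p) - x) x
      rw [sub_add_cancel] at this
      nlinarith
    · intro w hw
      rw [mem_ball_iff_norm] at hw
      refine Or.inl ⟨?_, hdisj w ?_⟩
      · have hq : p + t⁻¹ • (w - ((1 - t) • x + t • p)) ∈ A := by
          apply hpA
          rw [mem_ball_iff_norm, add_sub_cancel_left, norm_smul, Real.norm_eq_abs,
            abs_of_pos (inv_pos.2 ht), inv_mul_lt_iff₀ ht]
          linarith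
        have := hAc hxA' hq (sub_nonneg.2 ht1) ht.le (by ring)
        convert this using 1
        rw [smul_add, smul_smul, mul_inv_cancel₀ ht.ne', one_smul]
        module
      · rw [mem_ball_iff_norm]
        have := norm_add_le (w - ((1 - t) • x + t • p)) (((1 - t) • x + t • p) - x)
        rw [sub_add_sub_cancel] at this
        nlinarith

theorem gaussian_ball_lower (d : ℕ) (M : ℝ) {r : ℝ} (hr : 0 < r) :
    ∃ c : ENNReal, 0 < c ∧ ∀ z : EuclideanSpace ℝ (Fin d), ‖z‖ ≤ M →
      c ≤ gaussianMeasure d (Metric.ball z r) := by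
  refine ⟨ENNReal.ofReal ((2 * π) ^ (-(d : ℝ) / 2) * Real.exp (-(M + r) ^ 2 / 2)) *
    volume (Metric.ball (0 : EuclideanSpace ℝ (Fin d)) r), ?_, ?_⟩
  · apply ENNReal.mul_pos
    · exact (ENNReal.ofReal_pos.2 (by positivity)).ne'
    · exact (Metric.measure_ball_pos volume _ hr).ne'
  · intro z hz
    rw [gaussianMeasure, withDensity_apply _ Metric.isOpen_ball.measurableSet,
      ← Measure.addHaar_ball_center volume z r, ← setLIntegral_const]
    apply setLIntegral_mono' Metric.isOpen_ball.measurableSet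
    intro w hw
    rw [mem_ball_iff_norm] at hw
    have h1 := norm_add_le (w - z) z
    rw [sub_add_cancel] at h1
    have h2 : ‖w‖ ≤ M + r := by linarith
    have h3 : ‖w‖ ^ 2 ≤ (M + r) ^ 2 := pow_le_pow_left₀ (norm_nonneg w) h2 2
    gcongr

theorem boundaries_converge_uniformly_on_compacts {d : ℕ}
    (C : Set (EuclideanSpace ℝ (Fin d))) (Cn : ℕ → Set (EuclideanSpace ℝ (Fin d)))
    (hCcl : IsClosed C) (hCconv : Convex ℝ C) (hCint : (interior C).Nonempty)
    (hCncl : ∀ n, IsClosed (Cn n)) (hCnconv : ∀ n, Convex ℝ (Cn n))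
    (hconv : Tendsto (fun n => gaussianMeasure d ((C \ Cn n) ∪ (Cn n \ C))) atTop (nhds 0)) :
    ∀ R > (0 : ℝ), ∀ ε > (0 : ℝ), ∃ N : ℕ, ∀ n ≥ N,
      (frontier (Cn n) ∩ Metric.closedBall 0 R ⊆ {x | Metric.infDist x (frontier C) < ε}) ∧
      (frontier C ∩ Metric.closedBall 0 R ⊆ {x | Metric.infDist x (frontier (Cn n)) < ε}) := by
  intro R hR ε hε
  obtain ⟨p, hp⟩ := hCint
  obtain ⟨ρ, hρ, hpC⟩ := Metric.isOpen_iff.1 isOpen_interior p hp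
  have hpC' : Metric.ball p ρ ⊆ C := hpC.trans interior_subset
  have hpos : 0 < R + ‖p‖ + ρ / 2 := by positivity
  obtain ⟨t, ht, ht1, htε⟩ : ∃ t : ℝ, 0 < t ∧ t ≤ 1 ∧ t * (R + ‖p‖ + ρ / 2) ≤ ε := by
    refine ⟨min 1 (ε / (R + ‖p‖ + ρ / 2)), lt_min one_pos (by positivity), min_le_left _ _, ?_⟩
    rw [← le_div_iff₀ hpos]
    exact min_le_right _ _
  obtain ⟨r, hr, hr1, hr2, hr3⟩ : ∃ r : ℝ, 0 < r ∧ r ≤ t * (ρ / 2) ∧ r ≤ ε / 4 ∧ r ≤ ρ / 4 := by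
    refine ⟨min (t * (ρ / 2)) (min (ε / 4) (ρ / 4)), by positivity, min_le_left _ _,
      (min_le_right _ _).trans (min_le_left _ _), (min_le_right _ _).trans (min_le_right _ _)⟩
  obtain ⟨c, hc, hball⟩ := gaussian_ball_lower d (max (R + ε) (‖p‖ + ρ)) hr
  obtain ⟨N, hN⟩ := eventually_atTop.1 (hconv.eventually (gt_mem_nhds hc))
  refine ⟨N, fun n hn => ?_⟩
  have hno : ∀ z, ‖z‖ ≤ max (R + ε) (‖p‖ + ρ) →
      ¬ Metric.ball z r ⊆ (C \ Cn n) ∪ (Cn n \ C) := fun z hz hsub =>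
    absurd (hN n hn) (not_lt.2 ((hball z hz).trans (measure_mono hsub)))
  have hpn : Metric.ball p (ρ / 2) ⊆ Cn n := by
    intro y hy
    by_contra hyn
    obtain ⟨z, hz, hzn⟩ := exists_ball_disjoint (hCncl n) (hCnconv n) hyn hr
    rw [mem_ball_iff_norm] at hy
    have hzp : ‖z - p‖ < 3 * ρ / 4 := by
      have := norm_add_le (z - y) (y - p)
      rw [sub_add_sub_cancel] at this
      linarith
    refine hno z (le_max_of_le_right ?_) fun w hw => Or.inl ⟨hpC' ?_, hzn w hw⟩
    · have := norm_add_le (z - p) p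
      rw [sub_add_cancel] at this
      linarith
    · rw [mem_ball_iff_norm] at hw ⊢
      have := norm_add_le (w - z) (z - p)
      rw [sub_add_sub_cancel] at this
      linarith
  have hpC2 : Metric.ball p (ρ / 2) ⊆ C := (Metric.ball_subset_ball (by linarith)).trans hpC'
  constructor
  · rintro x ⟨hx, hxR⟩
    by_contra hcon
    obtain ⟨z, hz, hzs⟩ := key_ball (hCncl n) (hCnconv n) p x hε hpn ht ht1 htε hr hr1 hr2 hx
      (mem_closedBall_zero_iff.1 hxR) (not_lt.1 hcon)
    exact hno z (le_max_of_le_left hz) (by rwa [union_comm])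
  · rintro x ⟨hx, hxR⟩
    by_contra hcon
    obtain ⟨z, hz, hzs⟩ := key_ball hCcl hCconv p x hε hpC2 ht ht1 htε hr hr1 hr2 hx
      (mem_closedBall_zero_iff.1 hxR) (not_lt.1 hcon)
    exact hno z (le_max_of_le_left hz) hzs
end

section
/- Let C ⊆ ℝ^d be a closed convex set with nonempty interior and let γ be the standard Gaussian measure on ℝ^d. Then there exists a family (C_δ)_{δ>0} of closed convex sets such that for every δ > 0: C is contained in the interior of C_δ and the boundary ∂C_δ is of class C^∞; moreover γ(C_δ \ C) → 0 as δ → 0⁺. (Proposition A.4: smooth outer approximation of convex sets.) -/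
open Set Filter MeasureTheory Real

/-- The boundary of `S` is of class `C^∞`: near every boundary point, the boundary is the zero
level set of a smooth function with nonvanishing gradient on the boundary. -/
def HasSmoothBoundary {d : ℕ} (S : Set (EuclideanSpace ℝ (Fin d))) : Prop :=
  ∀ p ∈ frontier S, ∃ U : Set (EuclideanSpace ℝ (Fin d)), IsOpen U ∧ p ∈ U ∧
    ∃ f : EuclideanSpace ℝ (Fin d) → ℝ, ContDiff ℝ (⊤ : ℕ∞) f ∧
      frontier S ∩ U = {x ∈ U | f x = 0} ∧ ∀ x ∈ frontier S ∩ U, gradient f x ≠ 0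


open scoped Convolution ContDiff

lemma aux_convexOn_infDist {d : ℕ} (C : Set (EuclideanSpace ℝ (Fin d))) (hconv : Convex ℝ C)
    (hne : C.Nonempty) : ConvexOn ℝ univ (fun x => Metric.infDist x C) := by
  refine ⟨convex_univ, ?_⟩
  intro x _ y _ a b ha hb hab
  refine le_of_forall_pos_le_add fun ε hε => ?_
  obtain ⟨p, hp, hxp⟩ := (Metric.infDist_lt_iff hne).1 (lt_add_of_pos_right (Metric.infDist x C) hε)
  obtain ⟨q, hq, hyq⟩ := (Metric.infDist_lt_iff hne).1 (lt_add_of_pos_right (Metric.infDist y C) hε)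
  have h1 : Metric.infDist (a • x + b • y) C ≤ dist (a • x + b • y) (a • p + b • q) :=
    Metric.infDist_le_dist_of_mem (hconv hp hq ha hb hab)
  have h2 : dist (a • x + b • y) (a • p + b • q) ≤ a * dist x p + b * dist y q := by
    refine (dist_add_add_le _ _ _ _).trans ?_
    rw [dist_smul₀, dist_smul₀, Real.norm_of_nonneg ha, Real.norm_of_nonneg hb]
  have h3 : a * dist x p ≤ a * (Metric.infDist x C + ε) := mul_le_mul_of_nonneg_left hxp.le ha
  have h4 : b * dist y q ≤ b * (Metric.infDist y C + ε) := mul_le_mul_of_nonneg_left hyq.le hb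
  have h5 : a * ε + b * ε = ε := by rw [← add_mul, hab, one_mul]
  simp only [smul_eq_mul]
  linarith

lemma aux_mollify {d : ℕ} (C : Set (EuclideanSpace ℝ (Fin d))) (hconv : Convex ℝ C)
    (hne : C.Nonempty) (ε : ℝ) (hε : 0 < ε) :
    ∃ f : EuclideanSpace ℝ (Fin d) → ℝ, ContDiff ℝ (⊤ : ℕ∞) f ∧ ConvexOn ℝ univ f ∧
      ∀ x, |f x - Metric.infDist x C| ≤ ε := by
  have hg := aux_convexOn_infDist C hconv hne
  have hgc : Continuous (fun x => Metric.infDist x C) := Metric.continuous_infDist_pt C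
  have hgl := hgc.locallyIntegrable (μ := (volume : Measure (EuclideanSpace ℝ (Fin d))))
  let φ : ContDiffBump (0 : EuclideanSpace ℝ (Fin d)) := ⟨ε / 2, ε, half_pos hε, half_lt_self hε⟩
  have hex := φ.hasCompactSupport_normed (μ := volume) |>.convolutionExists_left
    (ContinuousLinearMap.lsmul ℝ ℝ) (φ.continuous_normed (μ := volume)) hgl
  refine ⟨φ.normed volume ⋆[ContinuousLinearMap.lsmul ℝ ℝ, volume]
    (fun x => Metric.infDist x C), ?_, ?_, ?_⟩
  · exact φ.hasCompactSupport_normed.contDiff_convolution_left _ φ.contDiff_normed hgl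
  · refine ⟨convex_univ, ?_⟩
    intro x _ y _ a b ha hb hab
    have hx := (hex x).integrable
    have hy := (hex y).integrable
    have hz := (hex (a • x + b • y)).integrable
    simp only [convolution_def, smul_eq_mul]
    rw [← integral_const_mul, ← integral_const_mul,
      ← integral_add (hx.const_mul a) (hy.const_mul b)]
    refine integral_mono hz ((hx.const_mul a).add (hy.const_mul b)) fun t => ?_
    have h1 := hg.2 (mem_univ (x - t)) (mem_univ (y - t)) ha hb hab
    have h2 : a • (x - t) + b • (y - t) = a • x + b • y - t := by
      rw [smul_sub, smul_sub, sub_add_sub_comm, ← add_smul, hab, one_smul]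
    rw [h2] at h1
    have h3 := mul_le_mul_of_nonneg_left h1 (φ.nonneg_normed (μ := volume) t)
    simp only [smul_eq_mul, ContinuousLinearMap.lsmul_apply, Pi.add_apply] at h3 ⊢
    linarith
  · intro x
    have := φ.dist_normed_convolution_le (μ := volume) (x₀ := x) (ε := ε)
      hgc.aestronglyMeasurable (fun y hy => by
        have := (Metric.lipschitz_infDist_pt C).dist_le_mul y x
        have hy' : dist y x < ε := hy
        simp only [NNReal.coe_one, one_mul] at this
        exact this.trans hy'.le)
    rwa [Real.dist_eq] at this

lemma aux_fderiv_ne {E : Type*} [NormedAddCommGroup E] [NormedSpace ℝ E] (f : E → ℝ)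
    (hf : Differentiable ℝ f) (hc : ConvexOn ℝ univ f) (x y : E) (hxy : f y < f x) :
    fderiv ℝ f x ≠ 0 := by
  intro h0
  have h1 : HasDerivAt (fun t : ℝ => f (x + t • (y - x))) 0 0 := by
    have h2 : HasDerivAt (fun t : ℝ => x + t • (y - x)) (y - x) 0 := by
      simpa using ((hasDerivAt_id (0 : ℝ)).smul_const (y - x)).const_add x
    have h3 : HasFDerivAt f (0 : E →L[ℝ] ℝ) (x + (0 : ℝ) • (y - x)) := by
      have := (hf x).hasFDerivAt
      rw [h0] at this
      simpa using this
    exact h3.comp_hasDerivAt (0 : ℝ) h2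
  have h4 := h1.tendsto_slope_zero_right
  have h5 : ∀ᶠ t : ℝ in nhdsWithin 0 (Ioi 0),
      t⁻¹ • (f (x + (0 + t) • (y - x)) - f (x + (0 : ℝ) • (y - x))) ≤ f y - f x := by
    filter_upwards [Ioo_mem_nhdsGT (zero_lt_one (α := ℝ))] with t ht
    have h6 := hc.2 (mem_univ x) (mem_univ y) (sub_nonneg.2 ht.2.le) ht.1.le (by ring)
    have h7 : (1 - t) • x + t • y = x + t • (y - x) := by
      rw [sub_smul, smul_sub, one_smul]; abel
    rw [h7] at h6
    simp only [smul_eq_mul, zero_add, zero_smul, add_zero] at h6 ⊢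
    rw [inv_mul_le_iff₀ ht.1]
    linarith
  have := le_of_tendsto h4 h5
  linarith

lemma aux_smooth {d : ℕ} (f : EuclideanSpace ℝ (Fin d) → ℝ) (hf : ContDiff ℝ (⊤ : ℕ∞) f)
    (hc : ConvexOn ℝ univ f) (c : ℝ) (y : EuclideanSpace ℝ (Fin d)) (hy : f y < c) :
    HasSmoothBoundary {x | f x ≤ c} := by
  have hd : Differentiable ℝ f := hf.differentiable (by simp)
  have hfr : frontier {x | f x ≤ c} = {x | f x = c} := by
    apply Subset.antisymm
    · exact frontier_le_subset_eq hf.continuous continuous_const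
    · intro x hx
      have hx' : f x = c := hx
      refine ⟨subset_closure hx'.le, fun hi => ?_⟩
      refine aux_fderiv_ne f hd hc x y (hx' ▸ hy) (IsLocalMax.fderiv_eq_zero ?_)
      filter_upwards [mem_interior_iff_mem_nhds.1 hi] with z hz
      rw [hx']; exact hz
  intro p _
  refine ⟨univ, isOpen_univ, mem_univ _, fun x => f x - c, hf.sub contDiff_const, ?_, ?_⟩
  · rw [hfr]; ext x; simp [sub_eq_zero]
  · rw [hfr]
    rintro x ⟨hx, -⟩ h
    have hx' : f x = c := hx
    refine aux_fderiv_ne f hd hc x y (hx' ▸ hy) ?_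
    unfold gradient at h
    rw [LinearIsometryEquiv.map_eq_zero_iff, fderiv_sub_const] at h
    exact h

lemma aux_finite (d : ℕ) : IsFiniteMeasure (gaussianMeasure d) := by
  refine isFiniteMeasure_withDensity_ofReal (Integrable.hasFiniteIntegral ?_)
  refine Integrable.const_mul ?_ _
  have h := GaussianFourier.integral_rexp_neg_mul_sq_norm (V := EuclideanSpace ℝ (Fin d))
    (b := 1 / 2) (by norm_num)
  have h2 : Integrable (fun v : EuclideanSpace ℝ (Fin d) => rexp (-(1 / 2) * ‖v‖ ^ 2)) := by
    apply Integrable.of_integral_ne_zero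
    rw [h]
    positivity
  refine h2.congr (Filter.Eventually.of_forall fun v => ?_)
  simp only
  congr 1
  ring

theorem smooth_outer_approximation_of_convex {d : ℕ}
    (C : Set (EuclideanSpace ℝ (Fin d))) (hcl : IsClosed C) (hconv : Convex ℝ C)
    (hint : (interior C).Nonempty) :
    ∃ Cd : ℝ → Set (EuclideanSpace ℝ (Fin d)),
      (∀ δ > (0 : ℝ), IsClosed (Cd δ) ∧ Convex ℝ (Cd δ) ∧ C ⊆ interior (Cd δ) ∧
        HasSmoothBoundary (Cd δ)) ∧
      Tendsto (fun δ => gaussianMeasure d (Cd δ \ C)) (nhdsWithin 0 (Set.Ioi 0)) (nhds 0) := by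
  have hne : C.Nonempty := hint.mono interior_subset
  have key : ∀ δ : ℝ, ∃ f : EuclideanSpace ℝ (Fin d) → ℝ, 0 < δ →
      (ContDiff ℝ (⊤ : ℕ∞) f ∧ ConvexOn ℝ univ f ∧ ∀ x, |f x - Metric.infDist x C| ≤ δ) := by
    intro δ
    by_cases h : 0 < δ
    · obtain ⟨f, hf⟩ := aux_mollify C hconv hne δ h
      exact ⟨f, fun _ => hf⟩
    · exact ⟨0, fun h' => absurd h' h⟩
  choose F hF using key
  have hlt : ∀ δ > 0, ∀ x ∈ C, F δ x < 2 * δ := by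
    intro δ hδ x hx
    have h1 := (abs_le.1 ((hF δ hδ).2.2 x)).2
    rw [Metric.infDist_zero_of_mem hx] at h1
    linarith
  refine ⟨fun δ => {x | F δ x ≤ 2 * δ}, ?_, ?_⟩
  · intro δ hδ
    obtain ⟨h1, h2, h3⟩ := hF δ hδ
    refine ⟨isClosed_le h1.continuous continuous_const, ?_, ?_, ?_⟩
    · simpa using h2.convex_le (2 * δ)
    · have ho : IsOpen {x | F δ x < 2 * δ} := isOpen_lt h1.continuous continuous_const
      exact fun x hx => interior_maximal (fun z (hz : F δ z < 2 * δ) => hz.le) ho (hlt δ hδ x hx)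
    · obtain ⟨y, hy⟩ := hne
      exact aux_smooth _ h1 h2 _ y (hlt δ hδ y hy)
  · haveI := aux_finite d
    have ht : Tendsto (fun δ : ℝ => gaussianMeasure d (Metric.cthickening (3 * δ) C \ C))
        (nhdsWithin 0 (Set.Ioi 0)) (nhds 0) := by
      have h1 := tendsto_measure_cthickening_of_isClosed (μ := gaussianMeasure d)
        ⟨1, zero_lt_one, measure_ne_top _ _⟩ hcl
      have h2 : Tendsto (fun δ : ℝ => 3 * δ) (nhdsWithin 0 (Set.Ioi 0)) (nhds 0) := by
        have : Tendsto (fun δ : ℝ => 3 * δ) (nhds 0) (nhds (3 * 0)) :=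
          (continuous_const.mul continuous_id).tendsto 0
        rw [mul_zero] at this
        exact this.mono_left nhdsWithin_le_nhds
      have h3 := ENNReal.Tendsto.sub (h1.comp h2)
        (tendsto_const_nhds (x := gaussianMeasure d C)) (Or.inl (measure_ne_top _ _))
      rw [tsub_self] at h3
      refine h3.congr fun δ => ?_
      exact (measure_sdiff (Metric.self_subset_cthickening C)
        hcl.measurableSet.nullMeasurableSet (measure_ne_top _ _)).symm
    refine tendsto_of_tendsto_of_tendsto_of_le_of_le' tendsto_const_nhds ht
      (Eventually.of_forall fun _ => zero_le) ?_
    filter_upwards [self_mem_nhdsWithin] with δ hδ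
    refine measure_mono (sdiff_subset_sdiff_left fun x hx => ?_)
    have hx' : F δ x ≤ 2 * δ := hx
    have h1 := (abs_le.1 ((hF δ hδ).2.2 x)).1
    rw [Metric.mem_cthickening_iff, ← ENNReal.ofReal_toReal (Metric.infEDist_ne_top hne)]
    refine ENNReal.ofReal_le_ofReal ?_
    change Metric.infDist x C ≤ 3 * δ
    linarith
end
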